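/- Let R be a commutative ring, let M and N be R-modules, let W be a finite group acting on N by R-linear automorphisms (via a group homomorphism ρ from W to the R-linear automorphisms of N), and let π : M → N and t : N → M be R-linear maps. Assume: (a) t ∘ π = (Fintype.card W : R) • id_M; (b) π ∘ t = ∑_{g ∈ W} ρ(g) as R-linear endomorphisms of N; (c) ρ(g) ∘ π = π for every g ∈ W; and (d) the image of the cardinality of W in R is a unit. Then π is injective and the range of π equals the submodule of W-invariants N^W = {n ∈ N : ρ(g)(n) = n for all g ∈ W}. (This is the transfer argument proved in the paper to deduce that equivariant cohomology for G identifies with the Weyl-group invariants of the torus-equivariant cohomology.) -/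

import Mathlib

/-!
Statement 7: Let `R` be a commutative ring, `M`, `N` be `R`-modules, `W` a finite group
acting on `N` by `R`-linear automorphisms via `ρ : W →* (N ≃ₗ[R] N)`, and `π : M →ₗ[R] N`,
`t : N →ₗ[R] M`.  Assume `t ∘ π = |W| • id`, `π ∘ t = ∑_{g ∈ W} ρ g`, `ρ g ∘ π = π` for all
`g`, and that the image of `|W|` in `R` is a unit.  Then `π` is injective and its range is
exactly the submodule of `W`-invariants `{n ∈ N | ρ g n = n for all g}`.
-/

theorem transfer_invariants {R : Type*} [CommRing R] {M N : Type*}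
    [AddCommGroup M] [Module R M] [AddCommGroup N] [Module R N]
    {W : Type*} [Group W] [Fintype W] (ρ : W →* (N ≃ₗ[R] N))
    (π : M →ₗ[R] N) (t : N →ₗ[R] M)
    (ha : t ∘ₗ π = (Fintype.card W : R) • LinearMap.id)
    (hb : π ∘ₗ t = ∑ g : W, ((ρ g).toLinearMap : N →ₗ[R] N))
    (hc : ∀ g : W, (ρ g).toLinearMap ∘ₗ π = π)
    (hd : IsUnit (Fintype.card W : R)) :
    Function.Injective π ∧
      ∀ n : N, (n ∈ LinearMap.range π ↔ ∀ g : W, ρ g n = n) := by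
  refine ⟨fun x y hxy => ?_, fun n => ⟨?_, fun hn => ?_⟩⟩
  · have h : ∀ z, t (π z) = (Fintype.card W : R) • z := fun z => by
      simpa using LinearMap.congr_fun ha z
    exact hd.smul_left_cancel.mp (by rw [← h, ← h, hxy])
  · rintro ⟨m, rfl⟩ g
    exact LinearMap.congr_fun (hc g) m
  · have h : π (t n) = (Fintype.card W : R) • n := by
      have := LinearMap.congr_fun hb n
      simpa [LinearMap.sum_apply, hn, Nat.cast_smul_eq_nsmul] using this
    obtain ⟨u, hu⟩ := hd
    refine ⟨(↑u⁻¹ : R) • t n, ?_⟩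
    rw [map_smul, h, ← hu, smul_smul, Units.inv_mul, one_smul]
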